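/- Let (f_n) be a sequence of upper semi-continuous log-concave densities on ℝ^d such that ∫ g f_n → ∫ g f for every bounded continuous g : ℝ^d → ℝ, where f is a probability density on ℝ^d. Then f agrees Lebesgue-almost everywhere with an upper semi-continuous log-concave density f̃, and if α₀ > 0 and β₀ ∈ ℝ are such that f̃(x) ≤ exp(−α₀‖x‖ + β₀) for all x ∈ ℝ^d, then for every α < α₀ we have ∫_{ℝ^d} e^{α‖x‖} |f_n(x) − f̃(x)| dx → 0 as n → ∞. -/

import Mathlib

open MeasureTheory Filter Set
open scoped ENNReal Topology

noncomputable section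

/-- `ℝ^d` with its Euclidean norm and Lebesgue measure. -/
abbrev Rd (d : ℕ) : Type := EuclideanSpace ℝ (Fin d)

/-- A nonnegative function is log-concave (`log f` is concave, with `log 0 := -∞`),
expressed multiplicatively via `f x ^ (1-t) * f y ^ t ≤ f ((1-t) • x + t • y)`. -/
def IsLogConcaveFn {E : Type*} [AddCommGroup E] [Module ℝ E] (f : E → ℝ) : Prop :=
  (∀ x, 0 ≤ f x) ∧
  ∀ x y : E, ∀ t : ℝ, t ∈ Set.Icc (0:ℝ) 1 →
    f x ^ (1 - t) * f y ^ t ≤ f ((1 - t) • x + t • y)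

/-- A probability density with respect to the (Lebesgue) measure of a `MeasureSpace`. -/
def IsDensity {E : Type*} [MeasureSpace E] (f : E → ℝ) : Prop :=
  (∀ x, 0 ≤ f x) ∧ Measurable f ∧ ∫⁻ x, ENNReal.ofReal (f x) = 1

/-- Membership in the class `F_d`: an upper semi-continuous log-concave probability
density. -/
def IsLCDensity {E : Type*} [MeasureSpace E] [TopologicalSpace E] [AddCommGroup E]
    [Module ℝ E] (f : E → ℝ) : Prop :=
  IsDensity f ∧ UpperSemicontinuous f ∧ IsLogConcaveFn f

/-- Membership in the class `P_d`: probability measures with finite first moment that are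
not concentrated on any affine hyperplane `{x | l x = c}` (`l` a nonzero linear
functional). -/
def MemP {E : Type*} [NormedAddCommGroup E] [NormedSpace ℝ E] [MeasureSpace E]
    (P : Measure E) : Prop :=
  IsProbabilityMeasure P ∧ Integrable (fun x => ‖x‖) P ∧
  ∀ (l : E →ₗ[ℝ] ℝ) (c : ℝ), l ≠ 0 → P {x | l x = c} < 1

/-- The log-concave projection predicate: `fs ∈ F_d` maximises `∫ log f dP` over `F_d`
(candidates whose objective is `-∞`, i.e. that vanish on a set of positive `P`-measure or
have non-integrable logarithm, are trivially dominated). -/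
def IsLCProj {E : Type*} [NormedAddCommGroup E] [NormedSpace ℝ E] [MeasureSpace E]
    (P : Measure E) (fs : E → ℝ) : Prop :=
  IsLCDensity fs ∧ (∀ᵐ x ∂P, 0 < fs x) ∧ Integrable (fun x => Real.log (fs x)) P ∧
  ∀ g : E → ℝ, IsLCDensity g → (∀ᵐ x ∂P, 0 < g x) →
    Integrable (fun x => Real.log (g x)) P →
    ∫ x, Real.log (g x) ∂P ≤ ∫ x, Real.log (fs x) ∂P

/-- `log y` with values in `[-∞, ∞)`, with the convention `log 0 := -∞`. -/
def elog (y : ℝ) : EReal := if y ≤ 0 then ⊥ else ((Real.log y : ℝ) : EReal)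

/-- Positive part of an extended real number, as an `ℝ≥0∞`. -/
def epos (a : EReal) : ℝ≥0∞ := if a = ⊤ then ⊤ else ENNReal.ofReal a.toReal

/-- `e^a` for an extended real `a`, valued in `[0,∞]`. -/
def expE (a : EReal) : ℝ≥0∞ :=
  if a = ⊥ then 0 else if a = ⊤ then ⊤ else ENNReal.ofReal (Real.exp a.toReal)

/-- Integral of an `EReal`-valued function: positive part minus negative part. -/
def erealIntegral {α : Type*} [MeasurableSpace α] (P : Measure α) (φ : α → EReal) : EReal :=
  ((∫⁻ x, epos (φ x) ∂P : ℝ≥0∞) : EReal) - ((∫⁻ x, epos (-(φ x)) ∂P : ℝ≥0∞) : EReal)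

/-- The class `Φ`: upper semi-continuous, concave functions `φ : E → [-∞, ∞)` with
`φ(x) → -∞` as `‖x‖ → ∞`. -/
def MemPhi {E : Type*} [NormedAddCommGroup E] [NormedSpace ℝ E] (φ : E → EReal) : Prop :=
  (∀ x, φ x ≠ ⊤) ∧ UpperSemicontinuous φ ∧
  (∀ x y : E, ∀ t : ℝ, t ∈ Set.Icc (0:ℝ) 1 →
    (((1 - t : ℝ)) : EReal) * φ x + ((t : ℝ) : EReal) * φ y ≤ φ ((1 - t) • x + t • y)) ∧
  Tendsto φ (Filter.comap (fun x => ‖x‖) Filter.atTop) (nhds ⊥)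

/-- The functional `L(φ, P) = ∫ φ dP - ∫ e^φ dx`. -/
def Lfun {E : Type*} [NormedAddCommGroup E] [NormedSpace ℝ E] [MeasureSpace E]
    (φ : E → EReal) (P : Measure E) : EReal :=
  erealIntegral P φ - ((∫⁻ x, expE (φ x) : ℝ≥0∞) : EReal)

/-- `L*(P) = sup_{φ ∈ Φ} L(φ, P)`. -/
def Lstar {E : Type*} [NormedAddCommGroup E] [NormedSpace ℝ E] [MeasureSpace E]
    (P : Measure E) : EReal :=
  ⨆ (φ : E → EReal) (_ : MemPhi φ), Lfun φ P

/-- Action of a matrix on a Euclidean vector. -/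
def mulVE {m d : ℕ} (A : Matrix (Fin m) (Fin d) ℝ) (x : Rd d) : Rd m :=
  (WithLp.equiv 2 (Fin m → ℝ)).symm (A.mulVec ((WithLp.equiv 2 (Fin d → ℝ)) x))

lemma IsDensity.integrable {E : Type*} [MeasureSpace E] {f : E → ℝ} (hf : IsDensity f) :
    Integrable f := by
  refine ⟨hf.2.1.aestronglyMeasurable, ?_⟩
  rw [hasFiniteIntegral_iff_ofReal (ae_of_all _ hf.1), hf.2.2]
  exact ENNReal.one_lt_top

lemma IsDensity.integral_eq_one {E : Type*} [MeasureSpace E] {f : E → ℝ} (hf : IsDensity f) :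
    ∫ x, f x = 1 := by
  rw [integral_eq_lintegral_of_nonneg_ae (ae_of_all _ hf.1) hf.2.1.aestronglyMeasurable, hf.2.2,
    ENNReal.toReal_one]

lemma IsDensity.setIntegral_le_one {E : Type*} [MeasureSpace E] {f : E → ℝ} (hf : IsDensity f)
    (s : Set E) : ∫ x in s, f x ≤ 1 :=
  hf.integral_eq_one ▸ setIntegral_le_integral hf.integrable (ae_of_all _ hf.1)

lemma IsDensity.isProbabilityMeasure {E : Type*} [MeasureSpace E] {f : E → ℝ}
    (hf : IsDensity f) :
    IsProbabilityMeasure ((volume : Measure E).withDensity fun x => ENNReal.ofReal (f x)) :=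
  ⟨by rw [withDensity_apply _ MeasurableSet.univ, setLIntegral_univ, hf.2.2]⟩

lemma IsLogConcaveFn.convex_superlevel {E : Type*} [AddCommGroup E] [Module ℝ E] {f : E → ℝ}
    (hf : IsLogConcaveFn f) (c : ℝ) : Convex ℝ {x | c ≤ f x} := by
  rcases le_or_gt c 0 with hc | hc
  · have : {x | c ≤ f x} = univ := eq_univ_of_forall fun x => hc.trans (hf.1 x)
    rw [this]
    exact convex_univ
  intro x hx y hy a b ha hb hab
  obtain rfl : a = 1 - b := by linarith
  calc c = c ^ (1 - b) * c ^ b := by rw [← Real.rpow_add hc]; simp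
    _ ≤ f x ^ (1 - b) * f y ^ b := by
        exact mul_le_mul (Real.rpow_le_rpow hc.le hx ha) (Real.rpow_le_rpow hc.le hy hb)
          (by positivity) (Real.rpow_nonneg (hf.1 x) _)
    _ ≤ _ := hf.2 x y b ⟨hb, by linarith⟩

/-- A closed convex set meeting finitely many suitably placed balls around `x` contains a
neighbourhood of `x` of comparable size. -/
lemma exists_finite_directions_closedBall_subset (E : Type*) [NormedAddCommGroup E]
    [InnerProductSpace ℝ E] [FiniteDimensional ℝ E] :
    ∃ T : Set E, T.Finite ∧ T ⊆ Metric.closedBall 0 1 ∧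
      ∀ K : Set E, Convex ℝ K → IsClosed K → ∀ (x : E) (r : ℝ), 0 < r →
        (∀ u ∈ T, (K ∩ Metric.closedBall (x + r • u) (r / 4)).Nonempty) →
        Metric.closedBall x (r / 2) ⊆ K := by
  have : ProperSpace E := FiniteDimensional.proper ℝ E
  obtain ⟨T, hT1, hT2, hT3⟩ :=
    (isCompact_closedBall (0 : E) 1).finite_cover_balls (e := 1 / 4) (by norm_num)
  refine ⟨T, hT2, hT1, fun K hK hKc x r hr h x' hx' => ?_⟩
  by_contra hxK
  obtain ⟨l, s, hl1, hl2⟩ := geometric_hahn_banach_closed_point hK hKc hxK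
  set v : E := (InnerProductSpace.toDual ℝ E).symm l with hv
  have hlv (y : E) : l y = inner ℝ v y := by
    rw [hv, InnerProductSpace.toDual_symm_apply]
  have hw : ‖v‖⁻¹ • v ∈ Metric.closedBall (0 : E) 1 := by
    rw [mem_closedBall_zero_iff, norm_smul, norm_inv, norm_norm]
    exact inv_mul_le_one
  obtain ⟨u, hu, huw⟩ := mem_iUnion₂.1 (hT3 hw)
  obtain ⟨y, hyK, hy⟩ := h u hu
  have h1 : l y < l x' := (hl1 y hyK).trans hl2
  have hin : inner ℝ v (‖v‖⁻¹ • v) = ‖v‖ := by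
    rw [inner_smul_right, real_inner_self_eq_norm_sq]
    rcases eq_or_ne ‖v‖ 0 with h0 | h0
    · simp [h0]
    · field_simp
  have hdec : y - x' = r • (‖v‖⁻¹ • v) - (r • (‖v‖⁻¹ • v - u) + ((x + r • u) - y) + (x' - x)) := by
    module
  rw [Metric.mem_ball, dist_eq_norm] at huw
  rw [Metric.mem_closedBall, dist_eq_norm, norm_sub_rev] at hy
  rw [Metric.mem_closedBall, dist_eq_norm] at hx'
  have hn : ‖r • (‖v‖⁻¹ • v - u) + ((x + r • u) - y) + (x' - x)‖ ≤ r := by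
    refine (norm_add₃_le).trans ?_
    rw [norm_smul, Real.norm_of_nonneg hr.le]
    nlinarith
  have h2 : 0 ≤ l (y - x') := by
    rw [hlv, hdec, inner_sub_right, inner_smul_right, hin]
    have := real_inner_le_norm v (r • (‖v‖⁻¹ • v - u) + ((x + r • u) - y) + (x' - x))
    have h3 := mul_le_mul_of_nonneg_left hn (norm_nonneg v)
    linarith
  rw [map_sub] at h2
  linarith

/-- Weak convergence of densities entails convergence of the masses of closed balls. -/
lemma tendsto_setIntegral_closedBall_of_weak {d : ℕ} {fn : ℕ → Rd d → ℝ} {f : Rd d → ℝ}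
    (hfn : ∀ n, IsDensity (fn n)) (hf : IsDensity f)
    (hconv : ∀ g : Rd d → ℝ, Continuous g → (∃ M : ℝ, ∀ x, |g x| ≤ M) →
      Tendsto (fun n => ∫ x, g x * fn n x) atTop (nhds (∫ x, g x * f x)))
    (x : Rd d) (r : ℝ) :
    Tendsto (fun n => ∫ y in Metric.closedBall x r, fn n y) atTop
      (𝓝 (∫ y in Metric.closedBall x r, f y)) := by
  have hint (g : Rd d → ℝ) (hg : IsDensity g) (h : Rd d → ℝ) :
      ∫ y, h y ∂((volume : Measure (Rd d)).withDensity fun x => ENNReal.ofReal (g x)) =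
        ∫ y, h y * g y := by
    rw [integral_withDensity_eq_integral_toReal_smul hg.2.1.ennreal_ofReal
      (ae_of_all _ fun _ => ENNReal.ofReal_lt_top)]
    refine integral_congr_ae (ae_of_all _ fun y => ?_)
    simp only [ENNReal.toReal_ofReal (hg.1 y), smul_eq_mul, mul_comm]
  let μn : ℕ → ProbabilityMeasure (Rd d) := fun n => ⟨_, (hfn n).isProbabilityMeasure⟩
  let μ : ProbabilityMeasure (Rd d) := ⟨_, hf.isProbabilityMeasure⟩
  have hlim : Tendsto μn atTop (𝓝 μ) := by
    rw [ProbabilityMeasure.tendsto_iff_forall_integral_tendsto]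
    intro g
    simp only [μn, μ, ProbabilityMeasure.coe_mk, hint _ (hfn _), hint _ hf]
    exact hconv g g.continuous ⟨‖g‖, fun x => g.norm_coe_le_norm x⟩
  have hfr : (μ : Measure (Rd d)) (frontier (Metric.closedBall x r)) = 0 :=
    withDensity_absolutelyContinuous _ _ ((convex_closedBall x r).addHaar_frontier volume)
  have hb := ProbabilityMeasure.tendsto_measure_of_null_frontier_of_tendsto' hlim hfr
  have key (g : Rd d → ℝ) (hg : IsDensity g) :
      (((volume : Measure (Rd d)).withDensity fun x => ENNReal.ofReal (g x))
        (Metric.closedBall x r)).toReal = ∫ y in Metric.closedBall x r, g y := by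
    rw [withDensity_apply _ Metric.isClosed_closedBall.measurableSet,
      integral_eq_lintegral_of_nonneg_ae (ae_of_all _ hg.1) hg.2.1.aestronglyMeasurable]
  have := (ENNReal.tendsto_toReal (measure_ne_top (μ : Measure (Rd d)) _)).comp hb
  simpa only [Function.comp_def, μn, μ, ProbabilityMeasure.coe_mk, key _ (hfn _), key _ hf]
    using this

/-- At almost every point, any value below the weak limit density is eventually a lower bound of
the sequence, uniformly on a neighbourhood. -/
lemma ae_forall_lt_eventually_le_on_closedBall {d : ℕ} {fn : ℕ → Rd d → ℝ} {f : Rd d → ℝ}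
    (hfn : ∀ n, IsLCDensity (fn n)) (hf : IsDensity f)
    (hconv : ∀ g : Rd d → ℝ, Continuous g → (∃ M : ℝ, ∀ x, |g x| ≤ M) →
      Tendsto (fun n => ∫ x, g x * fn n x) atTop (nhds (∫ x, g x * f x))) :
    ∀ᵐ x, ∀ c < f x, ∃ δ > 0, ∀ᶠ n in atTop, ∀ y ∈ Metric.closedBall x δ, c ≤ fn n y := by
  obtain ⟨T, hT1, hT2, hT3⟩ := exists_finite_directions_closedBall_subset (Rd d)
  filter_upwards [IsUnifLocDoublingMeasure.ae_tendsto_average volume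
    hf.integrable.locallyIntegrable 4] with x hx c hc
  have hav : ∀ u ∈ T, ∀ᶠ r in 𝓝[>] (0 : ℝ),
      c < ⨍ y in Metric.closedBall (x + r • u) (r / 4), f y := by
    intro u hu
    have hδ : Tendsto (fun r : ℝ => r / 4) (𝓝[>] 0) (𝓝[>] 0) := by
      refine tendsto_nhdsWithin_iff.2 ⟨?_, ?_⟩
      · have : Tendsto (fun r : ℝ => r / 4) (𝓝 0) (𝓝 (0 / 4)) :=
          (continuous_id.div_const 4).tendsto 0
        rw [zero_div] at this
        exact this.mono_left nhdsWithin_le_nhds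
      · filter_upwards [self_mem_nhdsWithin] with r hr
        exact div_pos hr (by norm_num : (0 : ℝ) < 4)
    refine (hx (fun r : ℝ => x + r • u) (fun r => r / 4) hδ ?_).eventually_const_lt hc
    filter_upwards [self_mem_nhdsWithin] with r hr
    have hr' : (0 : ℝ) < r := hr
    have hu1 : ‖u‖ ≤ 1 := by simpa using hT2 hu
    rw [Metric.mem_closedBall, dist_eq_norm, sub_add_cancel_left, norm_neg, norm_smul,
      Real.norm_of_nonneg hr'.le]
    nlinarith
  obtain ⟨r, hr, hr0⟩ := (((eventually_all_finite hT1).2 hav).and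
    (self_mem_nhdsWithin : ∀ᶠ r in 𝓝[>] (0 : ℝ), r ∈ Ioi 0)).exists
  have hr0' : (0 : ℝ) < r := hr0
  refine ⟨r / 2, by positivity, ?_⟩
  have hmass : ∀ u ∈ T, ∀ᶠ n in atTop,
      c * volume.real (Metric.closedBall (x + r • u) (r / 4)) <
        ∫ y in Metric.closedBall (x + r • u) (r / 4), fn n y := by
    intro u hu
    refine (tendsto_setIntegral_closedBall_of_weak (fun n => (hfn n).1) hf hconv _
      _).eventually_const_lt ?_
    have h1 := hr u hu
    have hpos : 0 < volume.real (Metric.closedBall (x + r • u) (r / 4)) :=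
      ENNReal.toReal_pos (Metric.measure_closedBall_pos _ _ (by positivity)).ne'
        measure_closedBall_lt_top.ne
    rwa [setAverage_eq, smul_eq_mul, inv_mul_eq_div, lt_div_iff₀ hpos] at h1
  filter_upwards [(eventually_all_finite hT1).2 hmass] with n hn
  refine hT3 {y | c ≤ fn n y} ((hfn n).2.2.convex_superlevel c)
    ((hfn n).2.1.isClosed_preimage c) x r hr0' fun u hu => ?_
  by_contra hemp
  have hlt : ∀ y ∈ Metric.closedBall (x + r • u) (r / 4), fn n y ≤ c := by
    intro y hy
    by_contra hcy
    exact hemp ⟨y, (not_le.1 hcy).le, hy⟩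
  have h2 := setIntegral_mono_on (hfn n).1.integrable.integrableOn
    (integrableOn_const (C := c) (hs := measure_closedBall_lt_top.ne))
    Metric.isClosed_closedBall.measurableSet hlt
  rw [setIntegral_const, smul_eq_mul, mul_comm] at h2
  exact absurd (hn u hu) (not_lt.2 h2)

/-- **Scheffé's lemma** in one-sided form: if densities are asymptotically bounded below by a
density almost everywhere, they converge to it in `L¹`. -/
lemma tendsto_integral_abs_sub_of_eventually_ge {E : Type*} [MeasureSpace E] {fn : ℕ → E → ℝ}
    {f : E → ℝ} (hfn : ∀ n, IsDensity (fn n)) (hf : IsDensity f)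
    (h : ∀ᵐ x, ∀ c < f x, ∀ᶠ n in atTop, c ≤ fn n x) :
    Tendsto (fun n => ∫ x, |fn n x - f x|) atTop (𝓝 0) := by
  have hdom : Tendsto (fun n => ∫ x, max (f x - fn n x) 0) atTop (𝓝 (∫ _ : E, (0 : ℝ))) := by
    refine tendsto_integral_of_dominated_convergence f (fun n =>
      ((hf.2.1.sub (hfn n).2.1).max measurable_const).aestronglyMeasurable) hf.integrable
      (fun n => ae_of_all _ fun x => ?_) ?_
    · rw [Real.norm_of_nonneg (le_max_right _ _)]
      exact max_le (by linarith [(hfn n).1 x]) (hf.1 x)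
    · filter_upwards [h] with x hx
      rw [tendsto_order]
      refine ⟨fun a ha => Eventually.of_forall fun n => ha.trans_le (le_max_right _ _),
        fun a ha => ?_⟩
      filter_upwards [hx (f x - a / 2) (by linarith)] with n hn
      exact max_lt (by linarith) ha
  have heq (n : ℕ) : ∫ x, |fn n x - f x| = 2 * ∫ x, max (f x - fn n x) 0 := by
    have hi : Integrable fun x => max (f x - fn n x) 0 :=
      (hf.integrable.sub (hfn n).integrable).pos_part
    have hi' : Integrable fun x => fn n x - f x := (hfn n).integrable.sub hf.integrable
    have : (fun x => |fn n x - f x|) =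
        fun x => 2 * max (f x - fn n x) 0 + (fn n x - f x) := by
      funext x
      rcases le_total (fn n x) (f x) with hx | hx
      · rw [abs_of_nonpos (by linarith), max_eq_left (by linarith)]; ring
      · rw [abs_of_nonneg (by linarith), max_eq_right (by linarith)]; ring
    rw [this, integral_add (hi.const_mul 2) hi',
      integral_const_mul, integral_sub (hfn n).integrable hf.integrable,
      (hfn n).integral_eq_one, hf.integral_eq_one]
    ring
  simp_rw [heq]
  simpa using hdom.const_mul 2

lemma exists_subseq_tendsto_ae_of_tendsto_integral_abs_sub {E : Type*} [MeasureSpace E]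
    {fn : ℕ → E → ℝ} {f : E → ℝ} (hfn : ∀ n, Integrable (fn n)) (hf : Integrable f)
    (h : Tendsto (fun n => ∫ x, |fn n x - f x|) atTop (𝓝 0)) :
    ∃ ns : ℕ → ℕ, StrictMono ns ∧
      ∀ᵐ x, Tendsto (fun i => fn (ns i) x) atTop (𝓝 (f x)) := by
  refine (tendstoInMeasure_of_tendsto_eLpNorm one_ne_zero
    (fun n => (hfn n).aestronglyMeasurable) hf.aestronglyMeasurable ?_).exists_seq_tendsto_ae
  have heq (n : ℕ) : eLpNorm (fn n - f) 1 volume = ENNReal.ofReal (∫ x, |fn n x - f x|) := by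
    rw [eLpNorm_one_eq_lintegral_enorm,
      ← ofReal_integral_norm_eq_lintegral_enorm ((hfn n).sub hf)]
    rfl
  simp_rw [heq]
  simpa using ENNReal.tendsto_ofReal h

/-- A log-concave function bounded below by `c` near `x₀` has mass around `midpoint z x₀`
controlled from below by its value at `z`. -/
lemma IsLogConcaveFn.sqrt_mul_le_setIntegral {d : ℕ} {f : Rd d → ℝ} (hf : IsLogConcaveFn f)
    (hfi : Integrable f) {x₀ : Rd d} {δ c : ℝ}
    (h : ∀ y ∈ Metric.closedBall x₀ δ, c ≤ f y) (z : Rd d) :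
    √(f z * c) * volume.real (Metric.closedBall (0 : Rd d) (δ / 2)) ≤
      ∫ w in Metric.closedBall (midpoint ℝ z x₀) (δ / 2), f w := by
  have hlow : ∀ w ∈ Metric.closedBall (midpoint ℝ z x₀) (δ / 2), √(f z * c) ≤ f w := by
    intro w hw
    have hy : (2 : ℝ) • w - z ∈ Metric.closedBall x₀ δ := by
      rw [Metric.mem_closedBall, dist_eq_norm] at hw ⊢
      have : (2 : ℝ) • w - z - x₀ = (2 : ℝ) • (w - midpoint ℝ z x₀) := by
        rw [midpoint_eq_smul_add, invOf_eq_inv]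
        module
      rw [this, norm_smul, Real.norm_of_nonneg (by norm_num)]
      linarith
    have h1 := hf.2 z ((2 : ℝ) • w - z) (1 / 2) ⟨by norm_num, by norm_num⟩
    have h2 : (1 - 1 / 2 : ℝ) • z + (1 / 2 : ℝ) • ((2 : ℝ) • w - z) = w := by module
    rw [h2] at h1
    refine le_trans ?_ h1
    rw [show (1 - 1 / 2 : ℝ) = 1 / 2 by norm_num, ← Real.sqrt_eq_rpow, ← Real.sqrt_eq_rpow,
      ← Real.sqrt_mul (hf.1 z)]
    exact Real.sqrt_le_sqrt (mul_le_mul_of_nonneg_left (h _ hy) (hf.1 z))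
  have h2 := setIntegral_mono_on
    (integrableOn_const (C := √(f z * c)) (μ := volume) (hs := measure_closedBall_lt_top.ne))
    hfi.integrableOn Metric.isClosed_closedBall.measurableSet hlow
  rw [setIntegral_const, smul_eq_mul, mul_comm] at h2
  refine le_trans (le_of_eq ?_) h2
  rw [Measure.real, Measure.real, Measure.addHaar_closedBall_center volume (midpoint ℝ z x₀)]

/-- A log-concave function that is at least `c` at `x₀` and at most `c * exp (-a * R)` on the
sphere of radius `R` decays exponentially at rate `a` outside that sphere. -/
lemma IsLogConcaveFn.le_exp_of_le_on_sphere {E : Type*} [NormedAddCommGroup E]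
    [NormedSpace ℝ E] {f : E → ℝ} (hf : IsLogConcaveFn f) {x₀ : E} {c a R : ℝ}
    (hc : 0 < c) (hc1 : c ≤ 1) (hR : 0 < R) (h₀ : c ≤ f x₀)
    (h : ∀ z, ‖z - x₀‖ = R → f z ≤ c * Real.exp (-a * R)) {x : E} (hx : R ≤ ‖x - x₀‖) :
    f x ≤ Real.exp (-a * ‖x - x₀‖) := by
  rcases (hf.1 x).eq_or_lt with h0 | h0
  · rw [← h0]; positivity
  have hρ : 0 < ‖x - x₀‖ := hR.trans_le hx
  set s := R / ‖x - x₀‖ with hs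
  have hs0 : 0 < s := by positivity
  have hs1 : s ≤ 1 := (div_le_one hρ).2 hx
  have hsR : s * ‖x - x₀‖ = R := div_mul_cancel₀ _ hρ.ne'
  have hz : ‖(1 - s) • x₀ + s • x - x₀‖ = R := by
    rw [show (1 - s) • x₀ + s • x - x₀ = s • (x - x₀) by module, norm_smul,
      Real.norm_of_nonneg hs0.le, hsR]
  have h1 : c * f x ^ s ≤ c * Real.exp (-a * R) := by
    refine le_trans ?_ ((hf.2 x₀ x s ⟨hs0.le, hs1⟩).trans (h _ hz))
    refine mul_le_mul_of_nonneg_right ?_ (Real.rpow_nonneg h0.le _)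
    calc c = c ^ (1 : ℝ) := (Real.rpow_one c).symm
      _ ≤ c ^ (1 - s) := Real.rpow_le_rpow_of_exponent_ge hc hc1 (by linarith)
      _ ≤ f x₀ ^ (1 - s) := Real.rpow_le_rpow hc.le h₀ (by linarith)
  have h2 : f x ^ s ≤ Real.exp (-a * ‖x - x₀‖) ^ s := by
    rw [← Real.exp_mul, show -a * ‖x - x₀‖ * s = -a * R by rw [← hsR]; ring]
    exact le_of_mul_le_mul_left h1 hc
  exact (Real.rpow_le_rpow_iff h0.le (Real.exp_pos _).le hs0).1 h2

lemma integrable_exp_neg_mul_norm {E : Type*} [NormedAddCommGroup E] [NormedSpace ℝ E]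
    [FiniteDimensional ℝ E] [MeasurableSpace E] [BorelSpace E] (μ : Measure E)
    [μ.IsAddHaarMeasure] {b : ℝ} (hb : 0 < b) : Integrable (fun x => Real.exp (-b * ‖x‖)) μ := by
  set k := Module.finrank ℝ E + 1 with hk
  have hi : Integrable (fun x : E => (1 + ‖x‖) ^ (-(k : ℝ))) μ :=
    integrable_one_add_norm (by rw [hk]; push_cast; linarith)
  refine (hi.const_mul (Real.exp b * (k.factorial / b ^ k))).mono'
    (by fun_prop) (ae_of_all _ fun x => ?_)
  have hx : 0 < 1 + ‖x‖ := by positivity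
  rw [Real.norm_of_nonneg (Real.exp_pos _).le, Real.rpow_neg hx.le, Real.rpow_natCast]
  have h1 := Real.pow_div_factorial_le_exp (b * (1 + ‖x‖)) (by positivity) k
  have h2 : Real.exp (-b * ‖x‖) = Real.exp b * (Real.exp (b * (1 + ‖x‖)))⁻¹ := by
    rw [← Real.exp_neg, ← Real.exp_add]; congr 1; ring
  rw [h2, mul_assoc]
  refine mul_le_mul_of_nonneg_left ?_ (Real.exp_pos _).le
  calc (Real.exp (b * (1 + ‖x‖)))⁻¹ ≤ ((b * (1 + ‖x‖)) ^ k / k.factorial)⁻¹ :=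
        inv_anti₀ (by positivity) h1
    _ = _ := by rw [mul_pow]; field_simp

/-- The points at which `c` is eventually a lower bound of the sequence. -/
def eventualSuperlevel {E : Type*} (fn : ℕ → E → ℝ) (c : ℝ) : Set E :=
  {x | ∀ᶠ n in atTop, c ≤ fn n x}

/-- The upper semicontinuous regularization of the pointwise lower limit of a sequence of
nonnegative functions. -/
def regularizedLiminf {E : Type*} [TopologicalSpace E] (fn : ℕ → E → ℝ) (x : E) : ℝ :=
  sSup {c | 0 ≤ c ∧ x ∈ closure (eventualSuperlevel fn c)}

section regularizedLiminf

variable {E : Type*} {fn : ℕ → E → ℝ} {M : ℝ}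

lemma eventualSuperlevel_anti : Antitone (eventualSuperlevel fn) :=
  fun _ _ hcd _ hx => hx.mono fun _ hn => hcd.trans hn

lemma convex_eventualSuperlevel [AddCommGroup E] [Module ℝ E]
    (hfn : ∀ n, IsLogConcaveFn (fn n)) (c : ℝ) : Convex ℝ (eventualSuperlevel fn c) := by
  intro x hx y hy a b ha hb hab
  filter_upwards [hx, hy] with n hnx hny
  exact (hfn n).convex_superlevel c hnx hny ha hb hab

variable [TopologicalSpace E]

lemma le_regularizedLiminf (hM : ∀ᶠ n in atTop, ∀ x, fn n x ≤ M) {x : E} {c : ℝ} (hc : 0 ≤ c)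
    (hx : x ∈ closure (eventualSuperlevel fn c)) : c ≤ regularizedLiminf fn x := by
  refine le_csSup ⟨M, fun c' hc' => ?_⟩ ⟨hc, hx⟩
  obtain ⟨y, hy⟩ := closure_nonempty_iff.1 ⟨x, hc'.2⟩
  obtain ⟨n, hn, hn'⟩ := (hM.and hy).exists
  exact hn'.trans (hn y)

lemma regularizedLiminf_nonneg (x : E) : 0 ≤ regularizedLiminf fn x :=
  Real.sSup_nonneg fun _ hc => hc.1

lemma mem_closure_of_lt_regularizedLiminf (hfn : ∀ n x, 0 ≤ fn n x) {x : E} {c : ℝ}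
    (hx : c < regularizedLiminf fn x) : x ∈ closure (eventualSuperlevel fn c) := by
  have hne : {c | 0 ≤ c ∧ x ∈ closure (eventualSuperlevel fn c)}.Nonempty :=
    ⟨0, le_rfl, subset_closure (Eventually.of_forall fun n => hfn n x)⟩
  obtain ⟨c', hc', hlt⟩ := exists_lt_of_lt_csSup hne hx
  exact closure_mono (eventualSuperlevel_anti hlt.le) hc'.2

lemma upperSemicontinuous_regularizedLiminf (hfn : ∀ n x, 0 ≤ fn n x)
    (hM : ∀ᶠ n in atTop, ∀ x, fn n x ≤ M) : UpperSemicontinuous (regularizedLiminf fn) := by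
  intro x c hx
  have h0 : 0 ≤ regularizedLiminf fn x := regularizedLiminf_nonneg x
  obtain ⟨s, hs1, hs2⟩ := exists_between hx
  have hmem : x ∉ closure (eventualSuperlevel fn s) := fun h =>
    absurd (le_regularizedLiminf hM (h0.trans hs1.le) h) (not_le.2 hs1)
  filter_upwards [isClosed_closure.isOpen_compl.mem_nhds hmem] with y hy
  refine lt_of_le_of_lt (not_lt.1 fun h => hy ?_) hs2
  exact mem_closure_of_lt_regularizedLiminf hfn h

lemma isLogConcaveFn_regularizedLiminf [AddCommGroup E] [Module ℝ E] [ContinuousAdd E]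
    [ContinuousConstSMul ℝ E] (hfn : ∀ n, IsLogConcaveFn (fn n))
    (hM : ∀ᶠ n in atTop, ∀ x, fn n x ≤ M) : IsLogConcaveFn (regularizedLiminf fn) := by
  refine ⟨regularizedLiminf_nonneg, fun x y t ht => ?_⟩
  set F := regularizedLiminf fn with hF
  have hF0 (z : E) : 0 ≤ F z := regularizedLiminf_nonneg z
  rcases ht.1.eq_or_lt with rfl | ht0
  · simp
  rcases ht.2.eq_or_lt with rfl | ht1
  · simp
  rcases (hF0 x).eq_or_lt with hx | hx
  · rw [← hx, Real.zero_rpow (by linarith), zero_mul]; exact hF0 _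
  rcases (hF0 y).eq_or_lt with hy | hy
  · rw [← hy, Real.zero_rpow (by linarith), mul_zero]; exact hF0 _
  have key : ∀ a b : ℝ, 0 ≤ a → a < F x → 0 ≤ b → b < F y →
      a ^ (1 - t) * b ^ t ≤ F ((1 - t) • x + t • y) := by
    intro a b ha hax hb hby
    refine le_regularizedLiminf hM (by positivity) ?_
    refine map_mem_closure₂ (f := fun x y : E => (1 - t) • x + t • y)
      (by simp only [Function.uncurry_def]; fun_prop)
      (mem_closure_of_lt_regularizedLiminf (fun n => (hfn n).1) hax)
      (mem_closure_of_lt_regularizedLiminf (fun n => (hfn n).1) hby) fun p hp q hq => ?_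
    filter_upwards [hp, hq] with n hnp hnq
    refine le_trans ?_ ((hfn n).2 p q t ht)
    exact mul_le_mul (Real.rpow_le_rpow ha hnp (by linarith)) (Real.rpow_le_rpow hb hnq ht.1)
      (by positivity) (Real.rpow_nonneg ((hfn n).1 p) _)
  refine le_of_forall_lt fun w hw => ?_
  set P := F x ^ (1 - t) * F y ^ t with hP
  have hP0 : 0 < P := by positivity
  obtain ⟨s, hs1, hs2⟩ := exists_between (max_lt ((div_lt_one hP0).2 hw) (zero_lt_one' ℝ))
  have hs0 : 0 < s := (le_max_right _ _).trans_lt hs1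
  have hws : w < s * P := (div_lt_iff₀ hP0).1 ((le_max_left _ _).trans_lt hs1)
  refine hws.trans_le ?_
  have h1 := key (s * F x) (s * F y) (by positivity) (by nlinarith) (by positivity) (by nlinarith)
  rw [Real.mul_rpow hs0.le hx.le, Real.mul_rpow hs0.le hy.le] at h1
  have h2 : s ^ (1 - t) * s ^ t = s := by rw [← Real.rpow_add hs0]; simp
  calc s * P = s ^ (1 - t) * F x ^ (1 - t) * (s ^ t * F y ^ t) := by
        rw [mul_mul_mul_comm, h2]
    _ ≤ _ := h1

end regularizedLiminf

/-- If `f` is asymptotically a lower bound and is the almost everywhere limit of a subsequence,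
then `f` agrees almost everywhere with the regularized lower limit. -/
lemma ae_eq_regularizedLiminf {d : ℕ} {fn : ℕ → Rd d → ℝ} {f : Rd d → ℝ} {M : ℝ}
    (hfn : ∀ n, IsLogConcaveFn (fn n)) (hM : ∀ᶠ n in atTop, ∀ x, fn n x ≤ M)
    (h : ∀ᵐ x, ∀ c < f x, ∀ᶠ n in atTop, c ≤ fn n x) {ns : ℕ → ℕ}
    (hns : StrictMono ns) (hlim : ∀ᵐ x, Tendsto (fun i => fn (ns i) x) atTop (𝓝 (f x))) :
    f =ᵐ[volume] regularizedLiminf fn := by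
  have hfr : ∀ᵐ x : Rd d, ∀ q : ℚ, x ∉ frontier (eventualSuperlevel fn (q : ℝ)) :=
    ae_all_iff.2 fun q => measure_eq_zero_iff_ae_notMem.1
      ((convex_eventualSuperlevel hfn _).addHaar_frontier volume)
  filter_upwards [h, hlim, hfr] with x hx1 hx2 hx3
  refine le_antisymm (le_of_forall_lt_imp_le_of_dense fun c hc => ?_) (not_lt.1 fun hlt => ?_)
  · rcases le_or_gt 0 c with h0 | h0
    · exact le_regularizedLiminf hM h0 (subset_closure (hx1 c hc))
    · exact h0.le.trans (regularizedLiminf_nonneg x)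
  · obtain ⟨q, hq1, hq2⟩ := exists_rat_btwn hlt
    have hcl := mem_closure_of_lt_regularizedLiminf (fun n => (hfn n).1) hq2
    have hmem : x ∈ eventualSuperlevel fn (q : ℝ) := by
      by_contra hnot
      exact hx3 q ⟨hcl, fun hint => hnot (interior_subset hint)⟩
    exact absurd (ge_of_tendsto hx2 (hns.tendsto_atTop.eventually hmem)) (not_le.2 hq1)

/-- Log-concave densities that are bounded below on a common ball and converge in `L¹` to a
density with exponential decay at rate `α₀` eventually decay uniformly at any rate `a < α₀`. -/
lemma exists_eventually_le_exp {d : ℕ} {fn : ℕ → Rd d → ℝ} {F : Rd d → ℝ} {x₀ : Rd d}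
    {δ c M α₀ β₀ a : ℝ} (hfn : ∀ n, IsLCDensity (fn n)) (hF : Integrable F)
    (hlim : Tendsto (fun n => ∫ x, |fn n x - F x|) atTop (𝓝 0))
    (hδ : 0 < δ) (hc : 0 < c) (hc1 : c ≤ 1)
    (hball : ∀ᶠ n in atTop, ∀ y ∈ Metric.closedBall x₀ δ, c ≤ fn n y)
    (hM0 : 0 < M) (hM : ∀ᶠ n in atTop, ∀ x, fn n x ≤ M) (hα₀ : 0 < α₀)
    (hdecay : ∀ x, F x ≤ Real.exp (-α₀ * ‖x‖ + β₀)) (ha : a < α₀) :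
    ∃ b, ∀ᶠ n in atTop, ∀ x, fn n x ≤ Real.exp (-a * ‖x‖ + b) := by
  set v := volume.real (Metric.closedBall (0 : Rd d) (δ / 2)) with hv
  have hv0 : 0 < v := ENNReal.toReal_pos
    (Metric.measure_closedBall_pos _ _ (by positivity)).ne' measure_closedBall_lt_top.ne
  set C := α₀ * (‖x₀‖ + δ / 2) + β₀ with hC
  obtain ⟨R, hRexp, hR⟩ : ∃ R : ℝ, 4 * Real.exp (2 * C) / c ^ 2 ≤ Real.exp ((α₀ - a) * R) ∧
      0 < R :=
    (((Real.tendsto_exp_atTop.comp (tendsto_id.const_mul_atTop (sub_pos.2 ha))).eventually_ge_atTop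
      _).and (eventually_gt_atTop 0)).exists
  set S := Real.exp (-α₀ * (R / 2) + C) with hS
  refine ⟨|Real.log M| + |a| * (R + ‖x₀‖), ?_⟩
  filter_upwards [hball, hM, hlim.eventually_le_const (show (0 : ℝ) < S * v by positivity)]
    with n hn hnM hnη x
  have hsphere : ∀ z, ‖z - x₀‖ = R → fn n z ≤ c * Real.exp (-a * R) := by
    intro z hz
    have h1 := (hfn n).2.2.sqrt_mul_le_setIntegral (hfn n).1.integrable hn z
    set B := Metric.closedBall (midpoint ℝ z x₀) (δ / 2) with hB
    have hBv : volume.real B = v := by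
      rw [hv, Measure.real, Measure.real, Measure.addHaar_closedBall_center]
    have hFB : ∫ w in B, F w ≤ S * v := by
      have h2 := setIntegral_mono_on (hF.integrableOn (s := B))
        (integrableOn_const (C := S) (hs := measure_closedBall_lt_top.ne))
        Metric.isClosed_closedBall.measurableSet fun w hw => ?_
      · rwa [setIntegral_const, smul_eq_mul, hBv, mul_comm] at h2
      · refine (hdecay w).trans (Real.exp_le_exp.2 ?_)
        have h3 : R / 2 ≤ ‖w‖ + δ / 2 + ‖x₀‖ := by
          have hdec : (1 / 2 : ℝ) • (z - x₀) = w + (midpoint ℝ z x₀ - w) - x₀ := by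
            rw [midpoint_eq_smul_add, invOf_eq_inv]
            module
          have hnorm : ‖(1 / 2 : ℝ) • (z - x₀)‖ = R / 2 := by
            rw [norm_smul, hz, Real.norm_of_nonneg (by norm_num)]; ring
          rw [Metric.mem_closedBall, dist_eq_norm, norm_sub_rev] at hw
          rw [← hnorm, hdec]
          refine (norm_sub_le _ _).trans ?_
          have := norm_add_le w (midpoint ℝ z x₀ - w)
          linarith
        rw [hC]
        nlinarith
    have hdiff : ∫ w in B, fn n w ≤ ∫ w in B, F w + |fn n w - F w| := by
      refine setIntegral_mono (hfn n).1.integrable.integrableOn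
        (hF.add ((hfn n).1.integrable.sub hF).abs).integrableOn fun w => ?_
      have := le_abs_self (fn n w - F w)
      simp only
      linarith
    have hη : ∫ w in B, |fn n w - F w| ≤ ∫ w, |fn n w - F w| :=
      setIntegral_le_integral ((hfn n).1.integrable.sub hF).abs (ae_of_all _ fun _ => abs_nonneg _)
    have habs : Integrable fun w => |fn n w - F w| := ((hfn n).1.integrable.sub hF).abs
    rw [integral_add hF.integrableOn habs.integrableOn] at hdiff
    have h4 : √(fn n z * c) ≤ 2 * S := by
      refine le_of_mul_le_mul_right ?_ hv0
      linarith
    have h5 : fn n z * c ≤ (2 * S) ^ 2 := (Real.sqrt_le_left (by positivity)).1 h4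
    have h6 : (2 * S) ^ 2 = 4 * Real.exp (2 * C) * Real.exp (-α₀ * R) := by
      rw [mul_pow, hS, ← Real.exp_nat_mul, mul_assoc, ← Real.exp_add]
      push_cast
      ring_nf
    have h7 : Real.exp ((α₀ - a) * R) * Real.exp (-α₀ * R) = Real.exp (-a * R) := by
      rw [← Real.exp_add]; ring_nf
    rw [div_le_iff₀ (by positivity)] at hRexp
    refine le_of_mul_le_mul_right ?_ hc
    calc fn n z * c ≤ 4 * Real.exp (2 * C) * Real.exp (-α₀ * R) := h6 ▸ h5
      _ ≤ Real.exp ((α₀ - a) * R) * c ^ 2 * Real.exp (-α₀ * R) := by gcongr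
      _ = c * (Real.exp ((α₀ - a) * R) * Real.exp (-α₀ * R)) * c := by ring
      _ = _ := by rw [h7]
  have hx1 : |‖x - x₀‖ - ‖x‖| ≤ ‖x₀‖ := by
    simpa using abs_norm_sub_norm_le (x - x₀) x
  rcases le_total R ‖x - x₀‖ with hxR | hxR
  · refine ((hfn n).2.2.le_exp_of_le_on_sphere hc hc1 hR
      (hn x₀ (Metric.mem_closedBall_self hδ.le)) hsphere hxR).trans (Real.exp_le_exp.2 ?_)
    have h1 : -a * (‖x - x₀‖ - ‖x‖) ≤ |a| * ‖x₀‖ := by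
      refine (le_abs_self _).trans ?_
      rw [abs_mul, abs_neg]
      exact mul_le_mul_of_nonneg_left hx1 (abs_nonneg a)
    have h2 := abs_nonneg (Real.log M)
    have h3 := mul_nonneg (abs_nonneg a) hR.le
    linarith
  · refine (hnM x).trans ?_
    rw [← Real.log_le_iff_le_exp hM0]
    have h1 : a * ‖x‖ ≤ |a| * (R + ‖x₀‖) := by
      refine mul_le_mul (le_abs_self a) ?_ (norm_nonneg x) (abs_nonneg a)
      linarith [(abs_le.1 hx1).1]
    linarith [le_abs_self (Real.log M)]

/-- Weak convergence of log-concave densities to a density implies that the limit is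
(a.e.) log-concave, and convergence holds in exponentially weighted total variation
distances. -/
theorem statement13 (d : ℕ) (fn : ℕ → Rd d → ℝ) (f : Rd d → ℝ)
    (hfn : ∀ n, IsLCDensity (fn n)) (hf : IsDensity f)
    (hconv : ∀ g : Rd d → ℝ, Continuous g → (∃ M : ℝ, ∀ x, |g x| ≤ M) →
      Tendsto (fun n => ∫ x, g x * fn n x) atTop (nhds (∫ x, g x * f x))) :
    ∃ ftil : Rd d → ℝ, IsLCDensity ftil ∧ f =ᵐ[volume] ftil ∧
      ∀ α₀ β₀ : ℝ, 0 < α₀ → (∀ x, ftil x ≤ Real.exp (-α₀ * ‖x‖ + β₀)) →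
        ∀ α : ℝ, α < α₀ →
          Tendsto
            (fun n => ∫⁻ x, ENNReal.ofReal (Real.exp (α * ‖x‖) * |fn n x - ftil x|))
            atTop (nhds 0) := by
  have hae := ae_forall_lt_eventually_le_on_closedBall hfn hf hconv
  have hlow : ∀ᵐ x, ∀ c < f x, ∀ᶠ n in atTop, c ≤ fn n x := by
    filter_upwards [hae] with x hx c hc
    obtain ⟨δ, hδ, h⟩ := hx c hc
    exact h.mono fun n hn => hn x (Metric.mem_closedBall_self hδ.le)
  have hL1 := tendsto_integral_abs_sub_of_eventually_ge (fun n => (hfn n).1) hf hlow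
  obtain ⟨x₀, hx₀, hx₀pos⟩ : ∃ x₀, (∀ c < f x₀, ∃ δ > 0, ∀ᶠ n in atTop,
      ∀ y ∈ Metric.closedBall x₀ δ, c ≤ fn n y) ∧ 0 < f x₀ := by
    by_contra! hcon
    have h0 : ∫ x, f x = ∫ _ : Rd d, (0 : ℝ) := by
      refine integral_congr_ae ?_
      filter_upwards [hae] with x hx
      exact le_antisymm (hcon x hx) (hf.1 x)
    rw [hf.integral_eq_one, integral_zero] at h0
    exact one_ne_zero h0
  obtain ⟨c, hc, hcx⟩ := exists_between (lt_min hx₀pos (zero_lt_one' ℝ))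
  have hc1 : c ≤ 1 := hcx.le.trans (min_le_right _ _)
  obtain ⟨δ, hδ, hball⟩ := hx₀ c (hcx.trans_le (min_le_left _ _))
  set v := volume.real (Metric.closedBall (0 : Rd d) (δ / 2)) with hv
  have hv0 : 0 < v := ENNReal.toReal_pos
    (Metric.measure_closedBall_pos _ _ (by positivity)).ne' measure_closedBall_lt_top.ne
  have hM : ∀ᶠ n in atTop, ∀ x, fn n x ≤ (1 / v) ^ 2 / c := by
    filter_upwards [hball] with n hn x
    have h1 := ((hfn n).2.2.sqrt_mul_le_setIntegral (hfn n).1.integrable hn x).trans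
      ((hfn n).1.setIntegral_le_one _)
    rw [le_div_iff₀ hc]
    exact (Real.sqrt_le_left (by positivity)).1 ((le_div_iff₀ hv0).2 h1)
  obtain ⟨ns, hns, hnslim⟩ := exists_subseq_tendsto_ae_of_tendsto_integral_abs_sub
    (fun n => (hfn n).1.integrable) hf.integrable hL1
  have hlc : ∀ n, IsLogConcaveFn (fn n) := fun n => (hfn n).2.2
  have hfF := ae_eq_regularizedLiminf hlc hM hlow hns hnslim
  have husc := upperSemicontinuous_regularizedLiminf (fun n => (hlc n).1) hM
  set F := regularizedLiminf fn with hFdef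
  have hFdens : IsDensity F := by
    refine ⟨regularizedLiminf_nonneg, husc.measurable, ?_⟩
    rw [← hf.2.2]
    refine lintegral_congr_ae ?_
    filter_upwards [hfF] with x hx
    rw [hx]
  refine ⟨F, ⟨hFdens, husc, isLogConcaveFn_regularizedLiminf hlc hM⟩, hfF, ?_⟩
  intro α₀ β₀ hα₀ hdecay α hα
  have hL1F : Tendsto (fun n => ∫ x, |fn n x - F x|) atTop (𝓝 0) := by
    refine hL1.congr fun n => integral_congr_ae ?_
    filter_upwards [hfF] with x hx
    rw [hx]
  obtain ⟨a, hαa, haα₀⟩ := exists_between hα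
  obtain ⟨b, hb⟩ := exists_eventually_le_exp hfn hFdens.integrable hL1F hδ hc hc1 hball
    (by positivity) hM hα₀ hdecay haα₀
  set D : Rd d → ℝ := fun x =>
    Real.exp b * Real.exp (-(a - α) * ‖x‖) + Real.exp β₀ * Real.exp (-(α₀ - α) * ‖x‖) with hD
  have hDi : Integrable D :=
    ((integrable_exp_neg_mul_norm volume (sub_pos.2 hαa)).const_mul _).add
      ((integrable_exp_neg_mul_norm volume (sub_pos.2 hα)).const_mul _)
  have hdom : ∀ᶠ n in atTop, ∀ x, Real.exp (α * ‖x‖) * |fn n x - F x| ≤ D x := by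
    filter_upwards [hb] with n hn x
    have h1 : |fn n x - F x| ≤ Real.exp (-a * ‖x‖ + b) + Real.exp (-α₀ * ‖x‖ + β₀) := by
      rw [abs_le]
      constructor <;> linarith [hn x, hdecay x, (hlc n).1 x, hFdens.1 x]
    refine (mul_le_mul_of_nonneg_left h1 (Real.exp_pos _).le).trans (le_of_eq ?_)
    rw [hD, mul_add]
    simp only [← Real.exp_add]
    ring_nf
  refine tendsto_of_subseq_tendsto fun ms hms => ?_
  obtain ⟨ks, hks, hkslim⟩ := exists_subseq_tendsto_ae_of_tendsto_integral_abs_sub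
    (fn := fun i => fn (ms i)) (fun i => (hfn _).1.integrable) hFdens.integrable (hL1F.comp hms)
  refine ⟨ks, ?_⟩
  rw [← lintegral_zero (μ := (volume : Measure (Rd d)))]
  refine tendsto_lintegral_filter_of_dominated_convergence (fun x => ENNReal.ofReal (D x))
    (Eventually.of_forall fun i => ?_) ?_ hDi.lintegral_lt_top.ne ?_
  · have h1 := (hfn (ms (ks i))).1.2.1
    have h2 := hFdens.2.1
    fun_prop
  · filter_upwards [(hms.comp hks.tendsto_atTop).eventually hdom] with i hi
    exact ae_of_all _ fun x => ENNReal.ofReal_le_ofReal (hi x)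
  · filter_upwards [hkslim] with x hx
    rw [← ENNReal.ofReal_zero]
    refine ENNReal.tendsto_ofReal ?_
    simpa using ((hx.sub_const (F x)).abs.const_mul (Real.exp (α * ‖x‖)))
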